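/- Let g ∈ C^∞(ℝ) be of order at most −1. Then for every n ≥ 1, the weighted divided difference (x_1, …, x_n) ↦ g{x_1, …, x_n} := (−1)^n x_1 ⋯ x_n · g[x_1, …, x_n] is a bounded function on ℝ^n. -/

import Mathlib

open MeasureTheory

/-- Divided difference of order `n-1` of `f` at the `n` points `x`, defined via the
integral formula over the simplex (and set to `0` for the empty tuple). -/
noncomputable def divDiff (f : ℝ → ℝ) : {n : ℕ} → (Fin n → ℝ) → ℝ
  | 0, _ => 0
  | m + 1, x =>
    ∫ t in {t : Fin m → ℝ | Monotone t ∧ ∀ j, t j ∈ Set.Icc (0 : ℝ) 1},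
      iteratedDeriv m f (x (Fin.last m) + ∑ j : Fin m, (x j.castSucc - x j.succ) * t j)

/-- `f` is of order at most `r`: for every `k` there are `R, c₂ > 0` with
`|f^(k)(x)| ≤ c₂ |x|^(r-k)` for all `|x| > R`. -/
def OrderAtMost (f : ℝ → ℝ) (r : ℝ) : Prop :=
  ∀ k : ℕ, ∃ R c₂ : ℝ, 0 < R ∧ 0 < c₂ ∧
    ∀ x : ℝ, R < |x| → |iteratedDeriv k f x| ≤ c₂ * |x| ^ (r - (k : ℝ))

/-- The ordered simplex `0 ≤ t₀ ≤ ⋯ ≤ t_{m-1} ≤ 1`. -/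
def orderedSimplex (m : ℕ) : Set (Fin m → ℝ) :=
  {t | Monotone t ∧ ∀ j, t j ∈ Set.Icc (0 : ℝ) 1}

/-- The convex combination of the points `x` with the weights given by the increments of `t`. -/
def simplexPoint {m : ℕ} (x : Fin (m + 1) → ℝ) (t : Fin m → ℝ) : ℝ :=
  x (Fin.last m) + ∑ j : Fin m, (x j.castSucc - x j.succ) * t j

theorem divDiff_eq_setIntegral (f : ℝ → ℝ) {m : ℕ} (x : Fin (m + 1) → ℝ) :
    divDiff f x = ∫ t in orderedSimplex m, iteratedDeriv m f (simplexPoint x t) := rfl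

theorem isCompact_orderedSimplex (m : ℕ) : IsCompact (orderedSimplex m) := by
  have h : orderedSimplex m =
      {t | Monotone t} ∩ Set.univ.pi fun _ : Fin m => Set.Icc (0 : ℝ) 1 := by
    ext t
    simp only [orderedSimplex, Set.mem_inter_iff, Set.mem_univ_pi]
    rfl
  rw [h]
  refine (isCompact_univ_pi fun _ => isCompact_Icc).inter_left ?_
  simp only [Monotone, Set.ofPred_forall]
  exact isClosed_iInter fun a => isClosed_iInter fun b => isClosed_iInter fun _ =>
    isClosed_le (continuous_apply a) (continuous_apply b)

theorem cons_mem_orderedSimplex_iff {m : ℕ} {s : ℝ} {t : Fin m → ℝ} :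
    (Fin.cons s t : Fin (m + 1) → ℝ) ∈ orderedSimplex (m + 1) ↔
      t ∈ orderedSimplex m ∧ s ∈ Set.Icc 0 ((Fin.snoc t 1 : Fin (m + 1) → ℝ) 0) := by
  cases m with
  | zero =>
    have h : (Fin.snoc t 1 : Fin 1 → ℝ) 0 = 1 := Fin.snoc_last (α := fun _ => ℝ) 1 t
    rw [h]
    simp [orderedSimplex, Subsingleton.monotone]
  | succ k =>
    have h : (Fin.snoc t 1 : Fin (k + 2) → ℝ) 0 = t 0 :=
      Fin.snoc_castSucc (α := fun _ => ℝ) 1 t 0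
    rw [h]
    simp only [orderedSimplex, Set.mem_ofPred_eq, Set.mem_Icc]
    constructor
    · rintro ⟨hm, hb⟩
      refine ⟨⟨fun i j hij => ?_, fun j => by simpa using hb j.succ⟩, by simpa using (hb 0).1, ?_⟩
      · simpa using hm (Fin.succ_le_succ_iff.2 hij)
      · simpa using hm (Fin.zero_le (Fin.succ (0 : Fin (k + 1))))
    · rintro ⟨⟨hm, hb⟩, h0, h1⟩
      constructor
      · rw [Fin.monotone_iff_le_succ]
        intro i
        cases i using Fin.cases with
        | zero => simpa using h1
        | succ i =>
          rw [← Fin.succ_castSucc]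
          simpa using hm (Fin.castSucc_le_succ i)
      · intro j
        cases j using Fin.cases with
        | zero => simpa using ⟨h0, h1.trans (hb 0).2⟩
        | succ i => simpa using hb i

theorem snoc_one_zero_nonneg {m : ℕ} {t : Fin m → ℝ} (ht : t ∈ orderedSimplex m) :
    0 ≤ (Fin.snoc t 1 : Fin (m + 1) → ℝ) 0 := by
  cases m with
  | zero => exact (Fin.snoc_last (α := fun _ => ℝ) 1 t).ge.trans' zero_le_one
  | succ k => exact (Fin.snoc_castSucc (α := fun _ => ℝ) 1 t 0).ge.trans' (ht.2 0).1

theorem simplexPoint_cons {m : ℕ} (x : Fin (m + 2) → ℝ) (s : ℝ) (t : Fin m → ℝ) :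
    simplexPoint x (Fin.cons s t) =
      simplexPoint (x ∘ (0 : Fin (m + 2)).succAbove) t + (x 0 - x 1) * s := by
  simp only [simplexPoint, Fin.sum_univ_succ, Fin.cons_zero, Fin.cons_succ, Function.comp,
    Fin.succAbove_zero, Fin.castSucc_zero, Fin.succ_zero_eq_one, Fin.succ_last, Fin.succ_castSucc]
  ring

theorem simplexPoint_succAbove_one {m : ℕ} (x : Fin (m + 2) → ℝ) (t : Fin m → ℝ) :
    simplexPoint (x ∘ (0 : Fin (m + 2)).succAbove) t +
        (x 0 - x 1) * (Fin.snoc t 1 : Fin (m + 1) → ℝ) 0 =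
      simplexPoint (x ∘ (1 : Fin (m + 2)).succAbove) t := by
  cases m with
  | zero =>
    have h : (Fin.snoc t 1 : Fin 1 → ℝ) 0 = 1 := Fin.snoc_last (α := fun _ => ℝ) 1 t
    rw [h]
    simp [simplexPoint]
  | succ k =>
    have h : (Fin.snoc t 1 : Fin (k + 2) → ℝ) 0 = t 0 :=
      Fin.snoc_castSucc (α := fun _ => ℝ) 1 t 0
    have h1 : ∀ i : Fin (k + 1), (1 : Fin (k + 3)).succAbove i.succ = i.succ.succ := fun i => by
      rw [← Fin.succ_zero_eq_one, Fin.succ_succAbove_succ, Fin.succAbove_zero]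
    have h2 : (1 : Fin (k + 3)).succAbove 0 = 0 := rfl
    rw [h]
    simp only [simplexPoint, Fin.sum_univ_succ, Function.comp, Fin.succAbove_zero,
      Fin.castSucc_zero, ← Fin.succ_castSucc, h1, h2, ← Fin.succ_last, Fin.succ_zero_eq_one]
    ring

theorem continuous_simplexPoint_uncurry (m : ℕ) :
    Continuous (Function.uncurry (simplexPoint (m := m))) := by
  unfold simplexPoint Function.uncurry
  fun_prop

theorem simplexPoint_le {m : ℕ} {x : Fin (m + 1) → ℝ} {t : Fin m → ℝ} {M : ℝ}
    (ht : t ∈ orderedSimplex m) (hx : ∀ i, x i ≤ M) : simplexPoint x t ≤ M := by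
  have key : ∀ (m : ℕ) (x : Fin (m + 1) → ℝ) (t : Fin m → ℝ) (T : ℝ), Monotone t →
      (∀ j, 0 ≤ t j ∧ t j ≤ T) → 0 ≤ T → (∀ i, x i ≤ M) →
      T * x (Fin.last m) + ∑ j : Fin m, (x j.castSucc - x j.succ) * t j ≤ T * M := by
    intro m
    induction m with
    | zero =>
      intro x t T _ _ hT hx
      simpa using mul_le_mul_of_nonneg_left (hx 0) hT
    | succ k ih =>
      intro x t T hm hb hT hx
      have h := ih (fun i => x i.castSucc) (fun j => t j.castSucc) (t (Fin.last k))
        (fun i j hij => hm (Fin.castSucc_le_castSucc_iff.2 hij))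
        (fun j => ⟨(hb _).1, hm (Fin.le_last _)⟩) (hb _).1 (fun i => hx _)
      have h' := mul_le_mul_of_nonneg_left (hx (Fin.last (k + 1)))
        (sub_nonneg.2 (hb (Fin.last k)).2)
      rw [Fin.sum_univ_castSucc]
      simp only [Fin.succ_castSucc, Fin.succ_last] at h ⊢
      linarith
  simpa [simplexPoint] using key m x t 1 ht.1 ht.2 zero_le_one hx

theorem simplexPoint_neg {m : ℕ} (x : Fin (m + 1) → ℝ) (t : Fin m → ℝ) :
    simplexPoint (fun i => -x i) t = -simplexPoint x t := by
  simp only [simplexPoint, neg_add, ← Finset.sum_neg_distrib]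
  congr 1
  exact Finset.sum_congr rfl fun j _ => by ring

theorem abs_simplexPoint_sub_le {m : ℕ} {x : Fin (m + 1) → ℝ} {t : Fin m → ℝ} {a r : ℝ}
    (ht : t ∈ orderedSimplex m) (hx : ∀ i, |x i - a| ≤ r) : |simplexPoint x t - a| ≤ r := by
  have h1 := simplexPoint_le ht (x := x) (M := a + r) fun i => by linarith [(abs_le.1 (hx i)).2]
  have h2 := simplexPoint_le ht (x := fun i => -x i) (M := r - a) fun i => by
    linarith [(abs_le.1 (hx i)).1]
  rw [simplexPoint_neg] at h2
  exact abs_le.2 ⟨by linarith, by linarith⟩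

theorem continuous_divDiff {f : ℝ → ℝ} {m : ℕ} (hf : Continuous (iteratedDeriv m f)) :
    Continuous fun x : Fin (m + 1) → ℝ => divDiff f x :=
  continuous_parametric_integral_of_continuous
    (f := fun x t => iteratedDeriv m f (simplexPoint x t))
    (hf.comp (continuous_simplexPoint_uncurry m)) (isCompact_orderedSimplex m)

theorem setIntegral_orderedSimplex_succ {m : ℕ} {F : (Fin (m + 1) → ℝ) → ℝ} (hF : Continuous F) :
    ∫ t in orderedSimplex (m + 1), F t =
      ∫ t in orderedSimplex m,
        ∫ s in (0 : ℝ)..(Fin.snoc t 1 : Fin (m + 1) → ℝ) 0, F (Fin.cons s t) := by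
  have hS := (isCompact_orderedSimplex (m + 1)).measurableSet
  have hS' := (isCompact_orderedSimplex m).measurableSet
  have hint : Integrable ((orderedSimplex (m + 1)).indicator F) :=
    (integrable_indicator_iff hS).2
      (hF.continuousOn.integrableOn_compact (isCompact_orderedSimplex (m + 1)))
  set e := MeasurableEquiv.piFinSuccAbove (fun _ : Fin (m + 1) => ℝ) 0 with he
  have hmp : MeasurePreserving e.symm :=
    (volume_preserving_piFinSuccAbove (fun _ : Fin (m + 1) => ℝ) 0).symm e
  have hes : ∀ (s : ℝ) (t : Fin m → ℝ), e.symm (s, t) = Fin.cons s t := fun s t => by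
    simp [he, MeasurableEquiv.piFinSuccAbove]
    rfl
  rw [← integral_indicator hS, ← hmp.integral_comp e.symm.measurableEmbedding,
    Measure.volume_eq_prod, integral_prod_symm (fun z => (orderedSimplex (m + 1)).indicator F (e.symm z))
      (hmp.integrable_comp_of_integrable hint),
    ← integral_indicator hS']
  refine integral_congr_ae (Filter.Eventually.of_forall fun t => ?_)
  by_cases ht : t ∈ orderedSimplex m
  · rw [Set.indicator_of_mem ht, intervalIntegral.integral_of_le (snoc_one_zero_nonneg ht),
      ← integral_Icc_eq_integral_Ioc, ← integral_indicator measurableSet_Icc]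
    refine integral_congr_ae (Filter.Eventually.of_forall fun s => ?_)
    simp only [hes, Set.indicator, cons_mem_orderedSimplex_iff, ht, true_and]
  · simp [hes, Set.indicator, cons_mem_orderedSimplex_iff, ht]

theorem sub_mul_divDiff {f : ℝ → ℝ} (hf : ContDiff ℝ (⊤ : ℕ∞) f) {m : ℕ}
    (x : Fin (m + 2) → ℝ) :
    (x 0 - x 1) * divDiff f x =
      divDiff f (x ∘ (1 : Fin (m + 2)).succAbove) -
        divDiff f (x ∘ (0 : Fin (m + 2)).succAbove) := by
  have hc : ∀ k : ℕ, Continuous (iteratedDeriv k f) := fun k =>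
    hf.continuous_iteratedDeriv k (by exact_mod_cast le_top)
  have hd : ∀ (k : ℕ) (y : ℝ), HasDerivAt (iteratedDeriv k f) (iteratedDeriv (k + 1) f y) y :=
    fun k y => by
      rw [iteratedDeriv_succ]
      exact (hf.differentiable_iteratedDeriv k (by exact_mod_cast WithTop.coe_lt_top k)
        y).hasDerivAt
  have hp : ∀ {k : ℕ} (y : Fin (k + 1) → ℝ), Continuous (simplexPoint y) := fun {k} y =>
    (continuous_simplexPoint_uncurry k).comp (Continuous.prodMk_right y)
  have hint : ∀ y : Fin (m + 1) → ℝ, IntegrableOn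
      (fun t => iteratedDeriv m f (simplexPoint y t)) (orderedSimplex m) := fun y =>
    ((hc m).comp (hp y)).continuousOn.integrableOn_compact (isCompact_orderedSimplex m)
  rw [divDiff_eq_setIntegral, divDiff_eq_setIntegral, divDiff_eq_setIntegral,
    setIntegral_orderedSimplex_succ
      (F := fun t => iteratedDeriv (m + 1) f (simplexPoint x t)) ((hc (m + 1)).comp (hp x)), ← integral_const_mul,
    ← integral_sub (hint _) (hint _)]
  refine integral_congr_ae (Filter.Eventually.of_forall fun t => ?_)
  simp only [simplexPoint_cons, ← simplexPoint_succAbove_one]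
  set A := simplexPoint (x ∘ (0 : Fin (m + 2)).succAbove) t
  have hderiv : ∀ s : ℝ, HasDerivAt (fun s => iteratedDeriv m f (A + (x 0 - x 1) * s))
      ((x 0 - x 1) * iteratedDeriv (m + 1) f (A + (x 0 - x 1) * s)) s := fun s => by
    have h := (hd m (A + (x 0 - x 1) * s)).comp s
      (((hasDerivAt_id s).const_mul (x 0 - x 1)).const_add A)
    rw [mul_comm]
    simpa [Function.comp_def] using h
  rw [← intervalIntegral.integral_const_mul, intervalIntegral.integral_eq_sub_of_hasDerivAt
    (fun s _ => hderiv s)]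
  · simp
  · have := hc (m + 1)
    exact Continuous.intervalIntegrable (by fun_prop) _ _

/-- The Lagrange form of the divided difference of `f` at the points of a finite set. -/
noncomputable def lagrangeDivDiff (f : ℝ → ℝ) (s : Finset ℝ) : ℝ :=
  ∑ a ∈ s, f a * ∏ b ∈ s.erase a, (a - b)⁻¹

theorem lagrangeDivDiff_erase (f : ℝ → ℝ) {s : Finset ℝ} {b : ℝ} (hb : b ∈ s) :
    lagrangeDivDiff f (s.erase b) =
      ∑ a ∈ s, (a - b) * (f a * ∏ c ∈ s.erase a, (a - c)⁻¹) := by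
  rw [← Finset.add_sum_erase s _ hb, sub_self, zero_mul, zero_add]
  refine Finset.sum_congr rfl fun a ha => ?_
  have hab : b ≠ a := (Finset.ne_of_mem_erase ha).symm
  rw [← Finset.mul_prod_erase (s.erase a) _ (Finset.mem_erase.2 ⟨hab, hb⟩),
    Finset.erase_right_comm]
  have : a - b ≠ 0 := sub_ne_zero.2 hab.symm
  field_simp

theorem sub_mul_lagrangeDivDiff (f : ℝ → ℝ) {s : Finset ℝ} {a b : ℝ} (ha : a ∈ s) (hb : b ∈ s) :
    (a - b) * lagrangeDivDiff f s =
      lagrangeDivDiff f (s.erase b) - lagrangeDivDiff f (s.erase a) := by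
  rw [lagrangeDivDiff_erase f ha, lagrangeDivDiff_erase f hb, ← Finset.sum_sub_distrib,
    lagrangeDivDiff, Finset.mul_sum]
  exact Finset.sum_congr rfl fun c _ => by ring

theorem image_comp_succAbove {m : ℕ} {x : Fin (m + 1) → ℝ} (hx : Function.Injective x)
    (p : Fin (m + 1)) :
    Finset.univ.image (x ∘ p.succAbove) = (Finset.univ.image x).erase (x p) := by
  rw [← Finset.image_image, ← Finset.image_erase hx, Fin.image_succAbove_univ]
  congr 1
  ext i
  simp

theorem divDiff_eq_lagrangeDivDiff {f : ℝ → ℝ} (hf : ContDiff ℝ (⊤ : ℕ∞) f) :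
    ∀ {n : ℕ} {x : Fin n → ℝ}, Function.Injective x →
      divDiff f x = lagrangeDivDiff f (Finset.univ.image x)
  | 0, x, _ => by simp [divDiff, lagrangeDivDiff]
  | 1, x, _ => by
    have h : orderedSimplex 0 = Set.univ := by
      ext t
      simp [orderedSimplex, Subsingleton.monotone]
    rw [divDiff_eq_setIntegral, h]
    simp [lagrangeDivDiff, simplexPoint, integral_unique, measureReal_def, volume_pi]
  | m + 2, x, hx => by
    have h01 : x 0 - x 1 ≠ 0 := sub_ne_zero.2 (hx.ne (by simp))
    apply mul_left_cancel₀ h01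
    rw [sub_mul_divDiff hf, divDiff_eq_lagrangeDivDiff hf (hx.comp Fin.succAbove_right_injective),
      divDiff_eq_lagrangeDivDiff hf (hx.comp Fin.succAbove_right_injective),
      image_comp_succAbove hx, image_comp_succAbove hx,
      sub_mul_lagrangeDivDiff f (Finset.mem_image_of_mem x (Finset.mem_univ 0))
        (Finset.mem_image_of_mem x (Finset.mem_univ 1))]

theorem OrderAtMost.exists_pow_mul_iteratedDeriv_le {f : ℝ → ℝ} (hord : OrderAtMost f (-1))
    (hf : ContDiff ℝ (⊤ : ℕ∞) f) (k : ℕ) :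
    ∃ C : ℝ, ∀ y : ℝ, |y| ^ (k + 1) * |iteratedDeriv k f y| ≤ C := by
  obtain ⟨R, c, hR, -, h⟩ := hord k
  have hc := hf.continuous_iteratedDeriv k (by exact_mod_cast le_top)
  obtain ⟨B, hB⟩ := (isCompact_Icc (a := -R) (b := R)).exists_bound_of_continuousOn
    (f := fun y => |y| ^ (k + 1) * |iteratedDeriv k f y|) (by fun_prop)
  refine ⟨max B c, fun y => ?_⟩
  rcases le_or_gt |y| R with hy | hy
  · exact ((le_abs_self _).trans (hB y (abs_le.1 hy))).trans (le_max_left _ _)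
  · have hy0 : 0 < |y| := hR.trans hy
    refine le_trans ?_ (le_max_right B c)
    calc |y| ^ (k + 1) * |iteratedDeriv k f y|
        ≤ |y| ^ (k + 1) * (c * |y| ^ ((-1 : ℝ) - (k : ℝ))) := by gcongr; exact h y hy
      _ = c * (|y| ^ ((k + 1 : ℕ) : ℝ) * |y| ^ ((-1 : ℝ) - (k : ℝ))) := by
        rw [Real.rpow_natCast]; ring
      _ = c := by
        rw [← Real.rpow_add hy0]
        push_cast
        rw [show (k : ℝ) + 1 + (-1 - k) = 0 by ring, Real.rpow_zero, mul_one]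

/-- If all points lie within `|a| / 2` of a point `a` of maximal modulus, the weighted divided
difference is controlled by the decay of the derivative. -/
theorem abs_prod_mul_divDiff_le {f : ℝ → ℝ} {m : ℕ} {C a : ℝ}
    (hC : ∀ y : ℝ, |y| ^ (m + 1) * |iteratedDeriv m f y| ≤ C) {x : Fin (m + 1) → ℝ}
    (hmax : ∀ i, |x i| ≤ |a|) (hnear : ∀ i, |x i - a| ≤ |a| / 2) :
    |(∏ i, x i) * divDiff f x| ≤ 2 ^ (m + 1) * C * volume.real (orderedSimplex m) := by
  rw [divDiff_eq_setIntegral, ← integral_const_mul, ← Real.norm_eq_abs]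
  refine norm_setIntegral_le_of_norm_le_const ((isCompact_orderedSimplex m).measure_lt_top (μ := volume))
    fun t ht => ?_
  set y := simplexPoint x t
  have hy : |a| ≤ 2 * |y| := by
    have h1 : |y - a| ≤ |a| / 2 := abs_simplexPoint_sub_le ht hnear
    have h2 := abs_sub_abs_le_abs_sub a y
    rw [abs_sub_comm] at h2
    linarith
  rw [Real.norm_eq_abs, abs_mul, Finset.abs_prod]
  calc (∏ i, |x i|) * |iteratedDeriv m f y|
      ≤ (∏ _i : Fin (m + 1), (2 * |y|)) * |iteratedDeriv m f y| := by
        gcongr with i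
        exact (hmax i).trans hy
    _ = 2 ^ (m + 1) * (|y| ^ (m + 1) * |iteratedDeriv m f y|) := by
        simp [mul_pow, mul_assoc]
    _ ≤ 2 ^ (m + 1) * C := by gcongr; exact hC y

theorem exists_abs_prod_mul_lagrangeDivDiff_le {f : ℝ → ℝ} (hf : ContDiff ℝ (⊤ : ℕ∞) f)
    (hord : OrderAtMost f (-1)) (n : ℕ) :
    ∃ C : ℝ, ∀ s : Finset ℝ, s.card = n → |(∏ a ∈ s, a) * lagrangeDivDiff f s| ≤ C := by
  induction n with
  | zero =>
    refine ⟨0, fun s hs => ?_⟩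
    simp [Finset.card_eq_zero.1 hs, lagrangeDivDiff]
  | succ m ih =>
    obtain ⟨D, hD⟩ := ih
    obtain ⟨C, hC⟩ := hord.exists_pow_mul_iteratedDeriv_le hf m
    refine ⟨max (2 ^ (m + 1) * C * volume.real (orderedSimplex m)) (4 * D), fun s hs => ?_⟩
    obtain ⟨a, ha, hmax⟩ := s.exists_max_image (fun b => |b|) (Finset.card_pos.1 (by omega))
    by_cases hnear : ∀ b ∈ s, |b - a| ≤ |a| / 2
    · refine le_trans ?_ (le_max_left _ _)
      set x : Fin (m + 1) → ℝ := fun i => s.orderEmbOfFin hs i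
      have hx : Function.Injective x := (s.orderEmbOfFin hs).injective
      have himg : Finset.univ.image x = s := by
        apply Finset.coe_injective
        simp [x]
      have hmem : ∀ i, x i ∈ s := s.orderEmbOfFin_mem hs
      have h := abs_prod_mul_divDiff_le hC (fun i => hmax _ (hmem i)) (fun i => hnear _ (hmem i))
      rwa [divDiff_eq_lagrangeDivDiff hf hx, himg,
        ← Finset.prod_image (f := fun b => b) hx.injOn, himg] at h
    · push Not at hnear
      obtain ⟨b, hb, hba⟩ := hnear
      refine le_trans ?_ (le_max_right _ _)
      have hpos : 0 < |a - b| := by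
        rw [abs_sub_comm]
        exact hba.trans_le' (by positivity)
      have hle : |a| ≤ 2 * |a - b| := by
        rw [abs_sub_comm]
        linarith
      have hDa := hD (s.erase a) (by rw [Finset.card_erase_of_mem ha]; omega)
      have hDb := hD (s.erase b) (by rw [Finset.card_erase_of_mem hb]; omega)
      refine le_of_mul_le_mul_left ?_ hpos
      calc |a - b| * |(∏ c ∈ s, c) * lagrangeDivDiff f s|
          = |(∏ c ∈ s, c) * ((a - b) * lagrangeDivDiff f s)| := by
            rw [← abs_mul]; congr 1; ring
        _ = |b * ((∏ c ∈ s.erase b, c) * lagrangeDivDiff f (s.erase b)) -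
              a * ((∏ c ∈ s.erase a, c) * lagrangeDivDiff f (s.erase a))| := by
            rw [sub_mul_lagrangeDivDiff f ha hb, ← mul_assoc, ← mul_assoc,
              Finset.mul_prod_erase s (fun c => c) ha, Finset.mul_prod_erase s (fun c => c) hb,
              mul_sub]
        _ ≤ |b| * D + |a| * D := by
            refine (abs_sub _ _).trans ?_
            rw [abs_mul b, abs_mul a]
            gcongr
        _ ≤ |a - b| * (4 * D) := by
            have hD0 : 0 ≤ D := (abs_nonneg _).trans hDa
            nlinarith [mul_le_mul_of_nonneg_right (hmax b hb) hD0,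
              mul_le_mul_of_nonneg_right hle hD0]

theorem dense_setOf_injective (n : ℕ) : Dense {x : Fin n → ℝ | Function.Injective x} := by
  intro x
  let γ : ℝ → Fin n → ℝ := fun ε i => x i + ε * (i : ℝ)
  have hγ : Filter.Tendsto γ (nhdsWithin 0 {0}ᶜ) (nhds x) := by
    have h : Continuous γ := by fun_prop
    have h0 : γ 0 = x := by
      ext i
      simp [γ]
    exact h0 ▸ h.continuousAt.tendsto.mono_left nhdsWithin_le_nhds
  refine mem_closure_of_tendsto hγ ?_
  have hne : ∀ i j : Fin n, ∀ᶠ ε in nhdsWithin (0 : ℝ) {0}ᶜ, i ≠ j → γ ε i ≠ γ ε j := by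
    intro i j
    by_cases hx : x i = x j
    · filter_upwards [self_mem_nhdsWithin] with ε hε hij h
      have h' : ε * (i : ℝ) = ε * (j : ℝ) := by simpa [γ, hx] using h
      exact hij (Fin.ext (by exact_mod_cast mul_left_cancel₀ hε h'))
    · have h0 : γ 0 i - γ 0 j ≠ 0 := by simpa [γ, sub_eq_zero] using hx
      have hcont : ContinuousAt (fun ε => γ ε i - γ ε j) 0 := by fun_prop
      filter_upwards [(hcont.eventually_ne h0).filter_mono nhdsWithin_le_nhds] with ε hε _
      exact sub_ne_zero.1 hε
  filter_upwards [Filter.eventually_all.2 fun i => Filter.eventually_all.2 (hne i)] with ε hε i j h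
  by_contra hij
  exact hε i j hij h

/-- if `g` is smooth of order at most `−1`, then for every `n ≥ 1`
the weighted divided difference `g{x_1,…,x_n} = (−1)^n x_1⋯x_n g[x_1,…,x_n]` is a
bounded function on `ℝ^n`. -/
theorem statement9 (g : ℝ → ℝ) (hg : ContDiff ℝ (⊤ : ℕ∞) g)
    (hord : OrderAtMost g (-1)) (n : ℕ) (hn : 1 ≤ n) :
    ∃ C : ℝ, ∀ x : Fin n → ℝ,
      |(-1 : ℝ) ^ n * (∏ j, x j) * divDiff g x| ≤ C := by
  obtain ⟨m, rfl⟩ := Nat.exists_eq_succ_of_ne_zero (Nat.one_le_iff_ne_zero.1 hn)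
  obtain ⟨C, hC⟩ := exists_abs_prod_mul_lagrangeDivDiff_le hg hord (m + 1)
  refine ⟨C, fun x => ?_⟩
  have hdiv := continuous_divDiff (hg.continuous_iteratedDeriv m (by exact_mod_cast le_top))
  have hclosed : IsClosed {x : Fin (m + 1) → ℝ | |(∏ j, x j) * divDiff g x| ≤ C} :=
    isClosed_le (by fun_prop) continuous_const
  have hsub : {x : Fin (m + 1) → ℝ | Function.Injective x} ⊆
      {x | |(∏ j, x j) * divDiff g x| ≤ C} := by
    intro x hx
    have h := hC (Finset.univ.image x) (by simp [Finset.card_image_of_injective _ hx])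
    rwa [Finset.prod_image hx.injOn, ← divDiff_eq_lagrangeDivDiff hg hx] at h
  have hx : |(∏ j, x j) * divDiff g x| ≤ C :=
    closure_minimal hsub hclosed (dense_setOf_injective (m + 1) x)
  simpa [mul_assoc, abs_mul] using hx
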